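/- There exists a constant C > 0 such that for every nonempty C∞-word u there exists a word z over Σ with uzu ∈ C^∞ and |uzu| ≤ C·|u|^{2.72}. -/

import Mathlib

/- Common framework: words over the alphabet Σ = {1,2} (represented as natural
numbers), run-length encoding, the derivative D, k-differentiable words C^k,
C∞-words, heights, roots, primitives, minimal/maximal words, simple extensions,
minimal forbidden words, and the left frontier Ψ. -/

namespace CinftyWords

/-- A word is a finite sequence of natural numbers. -/
abbrev Word := List ℕ

/-- `w` is a word over the alphabet Σ = {1,2}. -/
def IsWord (w : Word) : Prop := ∀ x ∈ w, x = 1 ∨ x = 2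

/-- Complement of a letter: exchanges 1 and 2. -/
def bar (x : ℕ) : ℕ := 3 - x

/-- Letterwise complement of a word. -/
def comp (w : Word) : Word := w.map bar

/-- Run-length encoding Δ: the sequence of lengths of maximal runs of equal
consecutive letters. -/
def rle (w : Word) : Word := (w.splitBy (· == ·)).map List.length

/-- Drop the first run if it has length 1. -/
def dropFirstRun1 (g : List (List ℕ)) : List (List ℕ) :=
  match g with
  | [] => []
  | r :: rs => if r.length = 1 then rs else r :: rs

/-- The derivative `D w`: the run-length encoding of the word obtained from `w`
by deleting its first and/or last run when that run has length 1. -/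
def D (w : Word) : Word :=
  ((dropFirstRun1 ((dropFirstRun1 (w.splitBy (· == ·))).reverse)).reverse).map List.length

/-- `w` is differentiable: `w` is a word over Σ and so is its run-length encoding. -/
def Diffble (w : Word) : Prop := IsWord w ∧ IsWord (rle w)

/-- The set C^k of k-differentiable words: `D^[j] w` is differentiable for all `j < k`
(so that `D^[k] w` is defined). -/
def CK (k : ℕ) : Set Word := {w | IsWord w ∧ ∀ j < k, Diffble (D^[j] w)}

/-- The set C∞ of words differentiable arbitrarily many times. -/
def Cinf : Set Word := {w | ∀ k : ℕ, w ∈ CK k}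

/-- The height of a C∞-word: the least `k` with `D^[k] w = []`. -/
noncomputable def height (w : Word) : ℕ := sInf {k | D^[k] w = []}

/-- The root of a C∞-word: `D^[height w - 1] w`. -/
noncomputable def root (w : Word) : Word := D^[height w - 1] w

/-- `v` is a primitive of `w`: `v` is differentiable and `D v = w`. -/
def IsPrimitive (v w : Word) : Prop := Diffble v ∧ D v = w

/-- A nonempty C∞-word is maximal if each `D^[j] w` (for `j ≤ height w - 2`) is a
primitive of `D^[j+1] w` of maximal length (vacuously true when `height w = 1`). -/
def MaximalWord (w : Word) : Prop :=
  w ∈ Cinf ∧ w ≠ [] ∧ ∀ j, j + 2 ≤ height w →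
    ∀ v, IsPrimitive v (D^[j + 1] w) → v.length ≤ (D^[j] w).length

/-- A nonempty C∞-word is minimal if each `D^[j] w` (for `j ≤ height w - 2`) is a
primitive of `D^[j+1] w` of minimal length (vacuously true when `height w = 1`). -/
def MinimalWord (w : Word) : Prop :=
  w ∈ Cinf ∧ w ≠ [] ∧ ∀ j, j + 2 ≤ height w →
    ∀ v, IsPrimitive v (D^[j + 1] w) → (D^[j] w).length ≤ v.length

/-- `w` is right maximal: a suffix of a maximal word. -/
def RightMaximal (w : Word) : Prop := ∃ v, MaximalWord v ∧ w <:+ v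

/-- `w` is left maximal: a prefix of a maximal word. -/
def LeftMaximal (w : Word) : Prop := ∃ v, MaximalWord v ∧ w <+: v

/-- `w` is right minimal: a suffix of a minimal word. -/
def RightMinimal (w : Word) : Prop := ∃ v, MinimalWord v ∧ w <:+ v

/-- `w` is left minimal: a prefix of a minimal word. -/
def LeftMinimal (w : Word) : Prop := ∃ v, MinimalWord v ∧ w <+: v

/-- `w` is right doubly extendable: both `w1` and `w2` are C∞-words. -/
def RightDoublyExt (w : Word) : Prop := w ++ [1] ∈ Cinf ∧ w ++ [2] ∈ Cinf

/-- `w` is left doubly extendable: both `1w` and `2w` are C∞-words. -/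
def LeftDoublyExt (w : Word) : Prop := 1 :: w ∈ Cinf ∧ 2 :: w ∈ Cinf

/-- `w` is fully extendable: `1w1`, `1w2`, `2w1`, `2w2` are all C∞-words. -/
def FullyExt (w : Word) : Prop :=
  ∀ x, (x = 1 ∨ x = 2) → ∀ y, (y = 1 ∨ y = 2) → x :: (w ++ [y]) ∈ Cinf

/-- `w'` is a right simple extension of `w`: `w' = w ++ s` is a C∞-word and at each
step the extension by the complementary letter is not a C∞-word. -/
def RightSimpleExt (w w' : Word) : Prop :=
  w' ∈ Cinf ∧ ∃ s : Word, IsWord s ∧ w' = w ++ s ∧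
    ∀ i < s.length, w ++ s.take i ++ [bar (s.getD i 0)] ∉ Cinf

/-- `w'` is a left simple extension of `w`. -/
def LeftSimpleExt (w w' : Word) : Prop := RightSimpleExt w.reverse w'.reverse

/-- `w'` is a simple extension of `w`: a right simple extension of a left simple
extension of `w`. -/
def SimpleExt (w w' : Word) : Prop := ∃ v, LeftSimpleExt w v ∧ RightSimpleExt v w'

/-- `m` is the maximal extension of `w`: a simple extension of `w` of maximal length. -/
def IsMaximalExtension (w m : Word) : Prop :=
  SimpleExt w m ∧ ∀ v, SimpleExt w v → v.length ≤ m.length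

/-- A language is factorial if it is closed under taking factors. -/
def Factorial (F : Set Word) : Prop := ∀ v ∈ F, ∀ u, u <:+: v → u ∈ F

/-- A language is anti-factorial if no word of it is a proper factor of another
word of it. -/
def AntiFactorial (M : Set Word) : Prop := ∀ u ∈ M, ∀ v ∈ M, u ≠ v → ¬ u <:+: v

/-- The set of minimal forbidden words of a (factorial) language `F`: words not
in `F` whose maximal proper prefix and maximal proper suffix are both in `F`. -/
def MF (F : Set Word) : Set Word := {v | v ∉ F ∧ v.dropLast ∈ F ∧ v.tail ∈ F}

/-- The height of a minimal forbidden word of C∞: `k + 1`, where `k` is the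
(unique) integer such that `w` is k-differentiable and `D^[k] w ∈ {111, 222}`. -/
noncomputable def MFheight (w : Word) : ℕ :=
  sInf {k | w ∈ CK k ∧ (D^[k] w = [1, 1, 1] ∨ D^[k] w = [2, 2, 2])} + 1

/-- The left frontier Ψ of a C∞-word: the word of length `height w` over {0,1,2}
recording the first letter of each derivative, with `2` replaced by `0` when the
first two letters of the previous derivative are distinct. -/
noncomputable def psi (w : Word) : List ℕ :=
  (List.range (height w)).map (fun i =>
    if i = 0 then w.getD 0 0
    else if (D^[i] w).getD 0 0 = 2 ∧ (D^[i - 1] w).getD 0 0 ≠ (D^[i - 1] w).getD 1 0 then 0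
    else (D^[i] w).getD 0 0)

end CinftyWords

namespace CinftyWords

theorem isWord_append {v w : Word} : IsWord (v ++ w) ↔ IsWord v ∧ IsWord w := by
  simp only [IsWord, List.mem_append]
  exact ⟨fun h => ⟨fun x hx => h x (.inl hx), fun x hx => h x (.inr hx)⟩,
    fun h x hx => hx.elim (h.1 x) (h.2 x)⟩

theorem isWord_cons {x : ℕ} {w : Word} : IsWord (x :: w) ↔ (x = 1 ∨ x = 2) ∧ IsWord w := by
  simp [IsWord]

theorem isWord_nil : IsWord [] := by simp [IsWord]

theorem IsWord.of_isInfix {v w : Word} (hw : IsWord w) (h : v <:+: w) : IsWord v :=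
  fun x hx => hw x (h.subset hx)

theorem bar_letter {a : ℕ} (ha : a = 1 ∨ a = 2) : bar a = 1 ∨ bar a = 2 := by
  rcases ha with rfl | rfl <;> simp [bar]

theorem bar_bar {a : ℕ} (ha : a = 1 ∨ a = 2) : bar (bar a) = a := by
  rcases ha with rfl | rfl <;> simp [bar]

theorem bar_ne {a : ℕ} (ha : a = 1 ∨ a = 2) : a ≠ bar a := by
  rcases ha with rfl | rfl <;> simp [bar]

theorem bar_iterate_letter {a : ℕ} (ha : a = 1 ∨ a = 2) (n : ℕ) :
    bar^[n] a = 1 ∨ bar^[n] a = 2 := by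
  induction n with
  | zero => exact ha
  | succ n ih => rw [Function.iterate_succ_apply']; exact bar_letter ih

theorem exists_bar_iterate_eq {a : ℕ} (ha : a = 1 ∨ a = 2) (n : ℕ) :
    ∃ b, (b = 1 ∨ b = 2) ∧ bar^[n] b = a := by
  induction n with
  | zero => exact ⟨a, ha, rfl⟩
  | succ n ih =>
    obtain ⟨b, hb, h⟩ := ih
    exact ⟨bar b, bar_letter hb, by rw [Function.iterate_succ_apply, bar_bar hb, h]⟩

/-- The word with alternating runs whose lengths are given by `W`, starting with a run of `a`. -/
def expand : ℕ → Word → Word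
  | _, [] => []
  | a, x :: W => List.replicate x a ++ expand (bar a) W

theorem expand_append (a : ℕ) (V W : Word) :
    expand a (V ++ W) = expand a V ++ expand (bar^[V.length] a) W := by
  induction V generalizing a with
  | nil => rfl
  | cons x V ih => simp [expand, ih]

theorem length_expand (a : ℕ) (W : Word) : (expand a W).length = W.sum := by
  induction W generalizing a with
  | nil => rfl
  | cons x W ih => simp [expand, ih]

theorem expand_isWord {a : ℕ} (ha : a = 1 ∨ a = 2) (W : Word) : IsWord (expand a W) := by
  induction W generalizing a with
  | nil => exact isWord_nil
  | cons x W ih =>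
    refine isWord_append.2 ⟨fun y hy => ?_, ih (bar_letter ha)⟩
    rw [List.eq_of_mem_replicate hy]; exact ha

/-- The runs of `expand a W`. -/
def runs : ℕ → Word → List (List ℕ)
  | _, [] => []
  | a, x :: W => List.replicate x a :: runs (bar a) W

theorem runs_flatten (a : ℕ) (W : Word) : (runs a W).flatten = expand a W := by
  induction W generalizing a with
  | nil => rfl
  | cons x W ih => simp [runs, expand, ih]

theorem map_length_runs (a : ℕ) (W : Word) : (runs a W).map List.length = W := by
  induction W generalizing a with
  | nil => rfl
  | cons x W ih => simp [runs, ih]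

theorem splitBy_expand {a : ℕ} (ha : a = 1 ∨ a = 2) {W : Word} (hW : ∀ x ∈ W, 0 < x) :
    (expand a W).splitBy (· == ·) = runs a W := by
  rw [← runs_flatten]
  apply List.splitBy_flatten
  · induction W generalizing a with
    | nil => simp [runs]
    | cons x W ih =>
      have := hW x (by simp)
      simp only [runs, List.mem_cons, not_or]
      refine ⟨?_, ih (bar_letter ha) fun y hy => hW y (by simp [hy])⟩
      intro h
      have := congrArg List.length h
      simp at this
      omega
  · induction W generalizing a with
    | nil => simp [runs]
    | cons x W ih =>
      intro m hm
      rcases List.mem_cons.1 hm with rfl | hm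
      · exact List.isChain_replicate_of_rel _ (by simp)
      · exact ih (bar_letter ha) (fun y hy => hW y (by simp [hy])) m hm
  · induction W generalizing a with
    | nil => simp [runs]
    | cons x W ih =>
      have ih' := ih (bar_letter ha) fun y hy => hW y (by simp [hy])
      cases W with
      | nil => simp [runs]
      | cons y W =>
        refine List.IsChain.cons_cons ?_ ih'
        have hx := hW x (by simp)
        have hy := hW y (by simp)
        refine ⟨by simp; omega, by simp; omega, ?_⟩
        simpa using bar_ne ha

theorem rle_expand {a : ℕ} (ha : a = 1 ∨ a = 2) {W : Word} (hW : ∀ x ∈ W, 0 < x) :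
    rle (expand a W) = W := by
  rw [rle, splitBy_expand ha hW, map_length_runs]

theorem IsWord.pos {W : Word} (hW : IsWord W) : ∀ x ∈ W, 0 < x := fun x hx => by
  rcases hW x hx with h | h <;> omega

theorem diffble_expand {a : ℕ} (ha : a = 1 ∨ a = 2) {W : Word} (hW : IsWord W) :
    Diffble (expand a W) :=
  ⟨expand_isWord ha W, by rwa [rle_expand ha hW.pos]⟩

theorem exists_expand {w : Word} (hw : IsWord w) :
    ∃ a W, (a = 1 ∨ a = 2) ∧ (∀ x ∈ W, 0 < x) ∧ w = expand a W := by
  induction w with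
  | nil => exact ⟨1, [], by simp, by simp, rfl⟩
  | cons c w ih =>
    obtain ⟨hc, hw'⟩ := isWord_cons.1 hw
    obtain ⟨a, W, ha, hW, rfl⟩ := ih hw'
    by_cases hca : c = a
    · subst hca
      cases W with
      | nil => exact ⟨c, [1], ha, by simp, by simp [expand]⟩
      | cons x W =>
        refine ⟨c, (x + 1) :: W, ha, ?_, by simp [expand, List.replicate_succ]⟩
        intro y hy
        rcases List.mem_cons.1 hy with rfl | hy
        · omega
        · exact hW y (by simp [hy])
    · refine ⟨c, 1 :: W, hc, ?_, ?_⟩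
      · intro y hy
        rcases List.mem_cons.1 hy with rfl | hy
        · omega
        · exact hW y hy
      · have : bar c = a := by
          rcases hc with rfl | rfl <;> rcases ha with rfl | rfl <;> simp_all [bar]
        simp [expand, this]

theorem Diffble.exists_expand {w : Word} (hw : Diffble w) :
    ∃ a W, (a = 1 ∨ a = 2) ∧ IsWord W ∧ w = expand a W := by
  obtain ⟨a, W, ha, hW, rfl⟩ := CinftyWords.exists_expand hw.1
  exact ⟨a, W, ha, by simpa [rle_expand ha hW] using hw.2, rfl⟩

/-- Delete the first letter of a word if it is `1`. -/
def dropOne : Word → Word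
  | 1 :: W => W
  | W => W

/-- Delete the first and the last letter of a word if they are `1`. -/
def trim (W : Word) : Word := (dropOne (dropOne W).reverse).reverse

theorem map_length_dropFirstRun1 (g : List (List ℕ)) :
    (dropFirstRun1 g).map List.length = dropOne (g.map List.length) := by
  cases g with
  | nil => rfl
  | cons r g =>
    by_cases h : r.length = 1
    · simp [dropFirstRun1, dropOne, h]
    · simp only [dropFirstRun1, h, if_false, List.map_cons]
      rw [dropOne.eq_2]
      simpa using fun h' => absurd h' h

theorem D_eq_trim (w : Word) : D w = trim (rle w) := by
  rw [D, trim, rle, ← map_length_dropFirstRun1, ← List.map_reverse, ← map_length_dropFirstRun1,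
    ← List.map_reverse]

theorem D_expand {a : ℕ} (ha : a = 1 ∨ a = 2) {W : Word} (hW : IsWord W) :
    D (expand a W) = trim W := by
  rw [D_eq_trim, rle_expand ha hW.pos]

theorem exists_dropOne (W : Word) : ∃ P, (P = [] ∨ P = [1]) ∧ W = P ++ dropOne W := by
  unfold dropOne
  split
  · exact ⟨[1], by simp, by simp⟩
  · exact ⟨[], by simp, by simp⟩

theorem exists_trim (W : Word) :
    ∃ P Q, (P = [] ∨ P = [1]) ∧ (Q = [] ∨ Q = [1]) ∧ W = P ++ trim W ++ Q := by
  obtain ⟨P, hP, h⟩ := exists_dropOne W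
  obtain ⟨Q, hQ, h'⟩ := exists_dropOne (dropOne W).reverse
  refine ⟨P, Q, hP, hQ, ?_⟩
  have h'' := congrArg List.reverse h'
  rw [List.reverse_reverse, List.reverse_append] at h''
  have hQ' : Q.reverse = Q := by rcases hQ with rfl | rfl <;> rfl
  rw [hQ'] at h''
  rw [List.append_assoc, trim, ← h'']
  exact h

theorem dropOne_two_cons (W : Word) : dropOne (2 :: W) = 2 :: W := rfl

theorem dropOne_append_of_ne_nil {V W : Word} (h : V ≠ []) :
    dropOne (V ++ W) = dropOne V ++ W := by
  cases V with
  | nil => exact absurd rfl h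
  | cons x V =>
    by_cases hx : x = 1
    · subst hx; rfl
    · have key : ∀ U : Word, dropOne (x :: U) = x :: U := fun U => by
        rw [dropOne.eq_2]; simpa using fun h' => absurd h' hx
      rw [List.cons_append, key, key, List.cons_append]

theorem dropOne_suffix (W : Word) : dropOne W <:+ W := by
  obtain ⟨P, -, h⟩ := exists_dropOne W
  exact ⟨P, h.symm⟩

theorem trim_infix (W : Word) : trim W <:+: W := by
  obtain ⟨P, Q, -, -, h⟩ := exists_trim W
  exact ⟨P, Q, h.symm⟩

theorem reverse_dropOne_reverse_infix_cons (y : ℕ) (W : Word) :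
    (dropOne W.reverse).reverse <:+: (dropOne (y :: W).reverse).reverse := by
  by_cases hW : W = []
  · simp [hW, dropOne]
  · rw [List.reverse_cons, dropOne_append_of_ne_nil (by simpa using hW), List.reverse_append]
    exact (List.suffix_append _ _).isInfix

theorem trim_infix_trim_one_cons (W : Word) : trim W <:+: trim (1 :: W) := by
  obtain ⟨P, hP, h⟩ := exists_dropOne W
  change (dropOne (dropOne W).reverse).reverse <:+: (dropOne W.reverse).reverse
  rcases hP with rfl | rfl
  · rw [List.nil_append] at h
    rw [← h]
  · conv_rhs => rw [h]
    exact reverse_dropOne_reverse_infix_cons 1 _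

theorem trim_append_singleton {W : Word} (hW : W ≠ []) (x : ℕ) :
    trim (W ++ [x]) = (dropOne (x :: (dropOne W).reverse)).reverse := by
  rw [trim, dropOne_append_of_ne_nil hW, List.reverse_append, List.reverse_singleton,
    List.singleton_append]

theorem trim_infix_trim_append_one (W : Word) : trim W <:+: trim (W ++ [1]) := by
  by_cases hW : W = []
  · simp [hW, trim, dropOne]
  · rw [trim_append_singleton hW]
    exact (List.reverse_infix.2 (dropOne_suffix _).isInfix)

theorem trim_append_one_infix (W : Word) : trim (W ++ [1]) <:+: trim (W ++ [2]) := by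
  by_cases hW : W = []
  · simp [hW, trim, dropOne]
  · rw [trim_append_singleton hW, trim_append_singleton hW, dropOne_two_cons, List.reverse_infix]
    exact (List.suffix_cons 2 _).isInfix

theorem Diffble.tail {w : Word} {x : ℕ} (h : Diffble (x :: w)) :
    Diffble w ∧ D w <:+: D (x :: w) := by
  obtain ⟨a, W, ha, hW, h⟩ := h.exists_expand
  cases W with
  | nil => simp [expand] at h
  | cons y W =>
    obtain ⟨hy, hW'⟩ := isWord_cons.1 hW
    rw [h, D_expand ha hW]
    rcases hy with rfl | rfl
    · obtain ⟨rfl, rfl⟩ : x = a ∧ w = expand (bar a) W := by simpa [expand] using h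
      rw [D_expand (bar_letter ha) hW']
      exact ⟨diffble_expand (bar_letter ha) hW', trim_infix_trim_one_cons W⟩
    · obtain ⟨rfl, rfl⟩ : x = a ∧ w = expand a (1 :: W) := by
        simpa [expand, List.replicate_succ] using h
      have hW'' : IsWord (1 :: W) := isWord_cons.2 ⟨.inl rfl, hW'⟩
      rw [D_expand ha hW'']
      exact ⟨diffble_expand ha hW'', reverse_dropOne_reverse_infix_cons 2 W⟩

theorem Diffble.dropLast {w : Word} {x : ℕ} (h : Diffble (w ++ [x])) :
    Diffble w ∧ D w <:+: D (w ++ [x]) := by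
  obtain ⟨a, W, ha, hW, h⟩ := h.exists_expand
  rcases List.eq_nil_or_concat W with rfl | ⟨W, y, rfl⟩
  · simp [expand] at h
  · rw [List.concat_eq_append] at *
    obtain ⟨hW', hy⟩ := isWord_append.1 hW
    rw [h, D_expand ha hW]
    rcases hy y (by simp) with rfl | rfl
    · obtain ⟨rfl, -⟩ : w = expand a W ∧ _ :=
        List.append_inj' (h.trans (expand_append a W [1])) rfl
      rw [D_expand ha hW']
      exact ⟨diffble_expand ha hW', trim_infix_trim_append_one W⟩
    · have h2 : expand a (W ++ [2]) = expand a (W ++ [1]) ++ [bar^[W.length] a] := by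
        simp [expand_append, expand, List.replicate_succ]
      obtain ⟨rfl, -⟩ := List.append_inj' (h.trans h2) rfl
      have hW'' : IsWord (W ++ [1]) := isWord_append.2 ⟨hW', by simp [IsWord]⟩
      rw [D_expand ha hW'']
      exact ⟨diffble_expand ha hW'', trim_append_one_infix W⟩

theorem Diffble.of_isInfix {v w : Word} (hw : Diffble w) (h : v <:+: w) :
    Diffble v ∧ D v <:+: D w := by
  obtain ⟨P, Q, rfl⟩ := h
  induction Q using List.reverseRecOn with
  | nil =>
    rw [List.append_nil] at *
    induction P with
    | nil => exact ⟨hw, List.infix_rfl⟩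
    | cons x P ih =>
      obtain ⟨h1, h2⟩ := hw.tail
      exact ⟨(ih h1).1, (ih h1).2.trans h2⟩
  | append_singleton Q x ih =>
    rw [← List.append_assoc] at *
    obtain ⟨h1, h2⟩ := hw.dropLast
    exact ⟨(ih h1).1, (ih h1).2.trans h2⟩

theorem mem_Cinf_iff_forall {w : Word} : w ∈ Cinf ↔ ∀ j, Diffble (D^[j] w) :=
  ⟨fun h j => (h (j + 1)).2 j (Nat.lt_succ_self j), fun h _ => ⟨(h 0).1, fun j _ => h j⟩⟩

theorem mem_Cinf_iff {w : Word} : w ∈ Cinf ↔ Diffble w ∧ D w ∈ Cinf := by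
  simp only [mem_Cinf_iff_forall]
  refine ⟨fun h => ⟨h 0, fun j => h (j + 1)⟩, fun h j => ?_⟩
  cases j with
  | zero => exact h.1
  | succ j => exact h.2 j

theorem isWord_of_mem_Cinf {w : Word} (h : w ∈ Cinf) : IsWord w := (h 0).1

theorem mem_Cinf_of_isInfix {v w : Word} (hw : w ∈ Cinf) (h : v <:+: w) : v ∈ Cinf := by
  have key : ∀ j, D^[j] v <:+: D^[j] w ∧ Diffble (D^[j] v) := by
    intro j
    induction j with
    | zero => exact ⟨h, ((mem_Cinf_iff_forall.1 hw 0).of_isInfix h).1⟩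
    | succ j ih =>
      have h1 := ((mem_Cinf_iff_forall.1 hw j).of_isInfix ih.1).2
      rw [← Function.iterate_succ_apply' D, ← Function.iterate_succ_apply' D] at h1
      exact ⟨h1, ((mem_Cinf_iff_forall.1 hw (j + 1)).of_isInfix h1).1⟩
  exact mem_Cinf_iff_forall.2 fun j => (key j).2

theorem expand_mem_Cinf {a : ℕ} (ha : a = 1 ∨ a = 2) {W : Word} (hW : W ∈ Cinf) :
    expand a W ∈ Cinf := by
  have hw := isWord_of_mem_Cinf hW
  rw [mem_Cinf_iff, D_expand ha hw]
  exact ⟨diffble_expand ha hw, mem_Cinf_of_isInfix hW (trim_infix W)⟩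

theorem nil_mem_Cinf : ([] : Word) ∈ Cinf := by
  have : ∀ j, D^[j] [] = [] := fun j => Function.iterate_fixed (by simp [D, dropFirstRun1]) j
  exact mem_Cinf_iff_forall.2 fun j => by
    rw [this]; exact ⟨isWord_nil, by simp [rle, isWord_nil]⟩

theorem IsWord.length_le_sum {W : Word} (hW : IsWord W) : W.length ≤ W.sum := by
  induction W with
  | nil => simp
  | cons x W ih =>
    obtain ⟨hx, hW⟩ := isWord_cons.1 hW
    have := ih hW
    simp only [List.length_cons, List.sum_cons]
    omega

theorem IsWord.sum_le {W : Word} (hW : IsWord W) : W.sum ≤ 2 * W.length := by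
  induction W with
  | nil => simp
  | cons x W ih =>
    obtain ⟨hx, hW⟩ := isWord_cons.1 hW
    have := ih hW
    simp only [List.length_cons, List.sum_cons]
    omega

theorem four_le_sum {v : Word} (hv : v ∈ Cinf) (h : 3 ≤ v.length) : 4 ≤ v.sum := by
  have hw := isWord_of_mem_Cinf hv
  match v, h with
  | a :: b :: c :: v, _ =>
    have habc : [a, b, c] ∈ Cinf := mem_Cinf_of_isInfix hv ⟨[], v, by simp⟩
    obtain ⟨ha, hb, hc, hv'⟩ : (a = 1 ∨ a = 2) ∧ (b = 1 ∨ b = 2) ∧ (c = 1 ∨ c = 2) ∧ IsWord v := by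
      simpa only [isWord_cons] using hw
    have hne : ¬ (a = 1 ∧ b = 1 ∧ c = 1) := by
      rintro ⟨rfl, rfl, rfl⟩
      have h3 := (mem_Cinf_iff.1 habc).1.2
      rw [show ([1, 1, 1] : Word) = expand 1 [3] from rfl, rle_expand (.inl rfl) (by simp)] at h3
      simp [IsWord] at h3
    simp only [List.sum_cons]
    omega

theorem expand_eq_append_last (a : ℕ) (ha : a = 1 ∨ a = 2) {x : Word} (hx : IsWord x)
    (hne : x ≠ []) : ∃ v, expand a x = v ++ [bar (bar^[x.length] a)] := by
  rcases List.eq_nil_or_concat x with rfl | ⟨x, y, rfl⟩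
  · exact absurd rfl hne
  · rw [List.concat_eq_append] at *
    have hb := bar_iterate_letter ha x.length
    have hl : bar (bar^[(x ++ [y]).length] a) = bar^[x.length] a := by
      rw [List.length_append, List.length_singleton, Function.iterate_succ_apply', bar_bar hb]
    rw [expand_append, hl]
    rcases hx y (by simp) with rfl | rfl
    · exact ⟨expand a x, rfl⟩
    · exact ⟨expand a x ++ [bar^[x.length] a], by simp [expand, List.replicate_succ]⟩

theorem expand_eq_cons (a : ℕ) {x : Word} (hx : IsWord x) (hne : x ≠ []) :
    ∃ v, expand a x = a :: v := by
  cases x with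
  | nil => exact absurd rfl hne
  | cons y x =>
    rcases (isWord_cons.1 hx).1 with rfl | rfl
    · exact ⟨_, rfl⟩
    · exact ⟨_, rfl⟩

/-- A differentiable word is determined by its derivative, a phase, and at most one letter on
each side. -/
theorem exists_eq_append_expand_D {u : Word} (hu : Diffble u) :
    ∃ c A B, (c = 1 ∨ c = 2) ∧ (A = [] ∨ A = [bar c]) ∧
      (B = [] ∨ B = [bar^[(D u).length] c]) ∧ u = A ++ expand c (D u) ++ B := by
  obtain ⟨b, W, hb, hW, rfl⟩ := hu.exists_expand
  rw [D_expand hb hW]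
  obtain ⟨α, β, hα, hβ, h⟩ := exists_trim W
  have hA : ∃ c A, (c = 1 ∨ c = 2) ∧ (A = [] ∨ A = [bar c]) ∧
      ∀ V, expand b (α ++ V) = A ++ expand c V := by
    rcases hα with rfl | rfl
    · exact ⟨b, [], hb, .inl rfl, fun V => rfl⟩
    · exact ⟨bar b, [b], bar_letter hb, .inr (by rw [bar_bar hb]), fun V => rfl⟩
  obtain ⟨c, A, hc, hA, hA'⟩ := hA
  have hB : ∃ B, (B = [] ∨ B = [bar^[(trim W).length] c]) ∧
      expand c (trim W ++ β) = expand c (trim W) ++ B := by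
    refine ⟨expand (bar^[(trim W).length] c) β, ?_, expand_append _ _ _⟩
    rcases hβ with rfl | rfl
    · exact .inl rfl
    · exact .inr rfl
  obtain ⟨B, hB, hB'⟩ := hB
  refine ⟨c, A, B, hc, hA, hB, ?_⟩
  conv_lhs => rw [h, List.append_assoc, hA', hB', ← List.append_assoc]

/-- Iterated expansion; the head of `r` is the letter used last. -/
def expandTower : List ℕ → Word → Word
  | [], W => W
  | a :: r, W => expand a (expandTower r W)

theorem expandTower_prefix {V W : Word} (r : List ℕ) (h : V <+: W) :
    expandTower r V <+: expandTower r W := by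
  induction r with
  | nil => exact h
  | cons a r ih =>
    obtain ⟨Q, hQ⟩ := ih
    exact ⟨_, by rw [expandTower, expandTower, ← hQ, expand_append]⟩

theorem expandTower_mem_Cinf {r : List ℕ} (hr : IsWord r) {W : Word} (hW : W ∈ Cinf) :
    expandTower r W ∈ Cinf := by
  induction r with
  | nil => exact hW
  | cons a r ih => exact expand_mem_Cinf (isWord_cons.1 hr).1 (ih (isWord_cons.1 hr).2)

/-- Every C∞-word of bounded height occurs in a suitable iterated expansion of any C∞-word,
inside the image of any factor of length six. -/
theorem exists_expandTower_eq (k : ℕ) : ∀ u ∈ Cinf, D^[k] u = [] → ∀ P Y₁ Y₂ : Word,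
    P ++ Y₁ ++ Y₂ ∈ Cinf → 3 ≤ Y₁.length → 3 ≤ Y₂.length →
    ∃ r, IsWord r ∧ r.length = k ∧ ∃ x y : Word, 3 ≤ x.length ∧ 3 ≤ y.length ∧
      expandTower r (P ++ Y₁ ++ Y₂) = expandTower r P ++ x ++ u ++ y := by
  induction k with
  | zero =>
    intro u _ hu P Y₁ Y₂ _ h1 h2
    obtain rfl : u = [] := hu
    exact ⟨[], isWord_nil, rfl, Y₁, Y₂, h1, h2, by simp [expandTower]⟩
  | succ k ih =>
    intro u hu hk P Y₁ Y₂ hZ h1 h2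
    obtain ⟨hud, hDu⟩ := mem_Cinf_iff.1 hu
    obtain ⟨r, hr, hrk, x, y, hx, hy, he⟩ := ih (D u) hDu hk P Y₁ Y₂ hZ h1 h2
    obtain ⟨c, A, B, hc, hA, hB, hueq⟩ := exists_eq_append_expand_D hud
    have hR := expandTower_mem_Cinf hr hZ
    rw [he] at hR
    have hxC : x ∈ Cinf := mem_Cinf_of_isInfix hR ⟨expandTower r P, D u ++ y, by simp⟩
    have hyC : y ∈ Cinf := mem_Cinf_of_isInfix hR ⟨expandTower r P ++ x ++ D u, [], by simp⟩
    obtain ⟨a, ha, hac⟩ := exists_bar_iterate_eq hc (expandTower r P ++ x).length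
    have hp := bar_iterate_letter ha (expandTower r P).length
    set p := bar^[(expandTower r P).length] a with hpdef
    have hpc : bar^[x.length] p = c := by
      rw [← hac, hpdef, ← Function.iterate_add_apply, List.length_append, add_comm]
    set e := bar^[(D u).length] c with hedef
    have hsum : expand a (expandTower r P ++ x ++ D u ++ y) =
        expand a (expandTower r P) ++ expand p x ++ expand c (D u) ++ expand e y := by
      have hphase : bar^[(expandTower r P ++ x ++ D u).length] a = e := by
        rw [List.length_append, add_comm, Function.iterate_add_apply, hac]
      rw [expand_append, expand_append, hphase, hac, expand_append]
    have hx' : ∃ x', 3 ≤ x'.length ∧ expand p x = x' ++ A := by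
      have hlen := length_expand p x
      have h4 := four_le_sum hxC hx
      rcases hA with rfl | rfl
      · exact ⟨expand p x, by omega, by simp⟩
      · obtain ⟨v, hv⟩ := expand_eq_append_last p hp (isWord_of_mem_Cinf hxC)
          (by rintro rfl; simp at hx)
        rw [hpc] at hv
        refine ⟨v, ?_, hv⟩
        rw [hv] at hlen
        simp at hlen
        omega
    have hy' : ∃ y', 3 ≤ y'.length ∧ expand e y = B ++ y' := by
      have hlen := length_expand e y
      have h4 := four_le_sum hyC hy
      rcases hB with rfl | rfl
      · exact ⟨expand e y, by omega, by simp⟩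
      · obtain ⟨v, hv⟩ := expand_eq_cons e (isWord_of_mem_Cinf hyC)
          (by rintro rfl; simp at hy)
        refine ⟨v, ?_, hv⟩
        rw [hv] at hlen
        simp at hlen
        omega
    obtain ⟨x', hx3, hxe⟩ := hx'
    obtain ⟨y', hy3, hye⟩ := hy'
    refine ⟨a :: r, isWord_cons.2 ⟨ha, hr⟩, by simp [hrk], x', y', hx3, hy3, ?_⟩
    conv_rhs => rw [hueq]
    rw [expandTower, he, hsum, hxe, hye, expandTower]
    simp only [List.append_assoc]

theorem exists_mem_Cinf_length_eq (n : ℕ) : ∃ Z ∈ Cinf, Z.length = n := by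
  have key : ∃ W, 2 :: W ∈ Cinf ∧ n ≤ (2 :: W).length := by
    induction n with
    | zero =>
      refine ⟨[], mem_Cinf_iff.2 ?_, by simp⟩
      have h1 : IsWord [1] := by simp [IsWord]
      have h2 : ([2] : Word) = expand 2 [1] := rfl
      rw [h2, D_expand (.inr rfl) h1]
      exact ⟨diffble_expand (.inr rfl) h1, nil_mem_Cinf⟩
    | succ n ih =>
      obtain ⟨W, hW, hn⟩ := ih
      refine ⟨2 :: expand 1 W, expand_mem_Cinf (a := 2) (.inr rfl) hW, ?_⟩
      have := (isWord_cons.1 (isWord_of_mem_Cinf hW)).2.length_le_sum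
      simp only [List.length_cons, length_expand] at *
      omega
  obtain ⟨W, hW, hn⟩ := key
  exact ⟨(2 :: W).take n, mem_Cinf_of_isInfix hW (List.take_prefix _ _).isInfix, by simpa using hn⟩

theorem sum_expand_add_sum_expand_bar {a : ℕ} (ha : a = 1 ∨ a = 2) (V : Word) :
    (expand a V).sum + (expand (bar a) V).sum = 3 * V.sum := by
  induction V generalizing a with
  | nil => rfl
  | cons x V ih =>
    have := ih (bar_letter ha)
    simp only [expand, List.sum_append, List.sum_replicate, List.sum_cons, smul_eq_mul]
    rcases ha with rfl | rfl <;> simp only [bar] at * <;> omega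

/-- All words of length `k`. -/
def words : ℕ → Finset Word
  | 0 => {[]}
  | k + 1 => (words k).image (List.cons 1) ∪ (words k).image (List.cons 2)

theorem mem_words {k : ℕ} {r : Word} (hr : IsWord r) (hk : r.length = k) : r ∈ words k := by
  induction r generalizing k with
  | nil => subst hk; simp [words]
  | cons a r ih =>
    subst hk
    obtain ⟨ha, hr⟩ := isWord_cons.1 hr
    have := ih hr rfl
    rcases ha with rfl | rfl <;> simp [words, this]

theorem sum_words_succ (k : ℕ) (f : Word → ℕ) :
    ∑ r ∈ words (k + 1), f r = ∑ r ∈ words k, (f (1 :: r) + f (2 :: r)) := by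
  rw [words, Finset.sum_union, Finset.sum_image, Finset.sum_image, Finset.sum_add_distrib]
  · exact (List.cons_injective).injOn
  · exact (List.cons_injective).injOn
  · simp [Finset.disjoint_left]

theorem card_words (k : ℕ) : (words k).card = 2 ^ k := by
  induction k with
  | zero => simp [words]
  | succ k ih =>
    rw [Finset.card_eq_sum_ones, sum_words_succ, Finset.sum_const, ih, pow_succ, smul_eq_mul]

theorem sum_words_sum_expandTower (k : ℕ) (Z : Word) :
    ∑ r ∈ words k, (expandTower r Z).sum = 3 ^ k * Z.sum := by
  induction k with
  | zero => simp [words, expandTower]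
  | succ k ih =>
    rw [sum_words_succ, pow_succ', mul_assoc, ← ih, Finset.mul_sum]
    exact Finset.sum_congr rfl fun r _ => sum_expand_add_sum_expand_bar (a := 1) (.inl rfl) _

theorem isWord_of_mem_words {k : ℕ} {r : Word} (h : r ∈ words k) : IsWord r := by
  induction k generalizing r with
  | zero => simp [words] at h; simp [h, IsWord]
  | succ k ih =>
    simp only [words, Finset.mem_union, Finset.mem_image] at h
    rcases h with ⟨r, hr, rfl⟩ | ⟨r, hr, rfl⟩
    · exact isWord_cons.2 ⟨.inl rfl, ih hr⟩
    · exact isWord_cons.2 ⟨.inr rfl, ih hr⟩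

theorem sum_words_length_expandTower_le (k : ℕ) {Z : Word} (hZ : Z ∈ Cinf) :
    ∑ r ∈ words k, (expandTower r Z).length ≤ 3 ^ k * (2 * Z.length) :=
  calc ∑ r ∈ words k, (expandTower r Z).length ≤ ∑ r ∈ words k, (expandTower r Z).sum :=
        Finset.sum_le_sum fun _ hr => (isWord_of_mem_Cinf
          (expandTower_mem_Cinf (isWord_of_mem_words hr) hZ)).length_le_sum
    _ = 3 ^ k * Z.sum := sum_words_sum_expandTower k Z
    _ ≤ _ := Nat.mul_le_mul_left _ (isWord_of_mem_Cinf hZ).sum_le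

/-- A C∞-word of height at most `k` recurs within a gap of order `3 ^ k`. -/
theorem exists_repetition {k : ℕ} {u : Word} (hu : u ∈ Cinf) (hk : D^[k] u = []) :
    ∃ z, IsWord z ∧ u ++ z ++ u ∈ Cinf ∧ (u ++ z ++ u).length ≤ 24 * 3 ^ k + u.length := by
  obtain ⟨Z, hZ, hZl⟩ := exists_mem_Cinf_length_eq (6 * (2 ^ (k + 1) + 2))
  set T := 2 ^ (k + 1) + 2 with hT
  have hocc : ∀ t : ℕ, ∃ r, ∃ x y : Word, t < T → r ∈ words k ∧
      expandTower r (Z.take (6 * (t + 1))) = expandTower r (Z.take (6 * t)) ++ x ++ u ++ y := by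
    intro t
    by_cases ht : t < T
    · have hsplit : Z.take (6 * (t + 1)) =
          Z.take (6 * t) ++ (Z.drop (6 * t)).take 3 ++ (Z.drop (6 * t + 3)).take 3 := by
        rw [show 6 * (t + 1) = 6 * t + 3 + 3 by ring, List.take_add, List.take_add]
      have hC : Z.take (6 * (t + 1)) ∈ Cinf :=
        mem_Cinf_of_isInfix hZ (List.take_prefix _ _).isInfix
      rw [hsplit] at hC
      obtain ⟨r, hr, hrk, x, y, -, -, h⟩ := exists_expandTower_eq k u hu hk _ _ _ hC
        (by simp; omega) (by simp; omega)
      rw [← hsplit] at h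
      exact ⟨r, x, y, fun _ => ⟨mem_words hr hrk, h⟩⟩
    · exact ⟨[], [], [], fun h => absurd h ht⟩
  choose r x y h using hocc
  set G := 24 * 3 ^ k with hG
  have hGpos : 0 < G := by positivity
  set pos : ℕ → ℕ := fun t => (expandTower (r t) (Z.take (6 * t)) ++ x t).length with hpos
  set S := (words k).sigma fun r => Finset.range ((expandTower r Z).length / G + 1) with hS
  have hcard : S.card < (Finset.range T).card := by
    rw [Finset.card_range, hS, Finset.card_sigma]
    simp only [Finset.card_range, Finset.sum_add_distrib, Finset.sum_const, card_words, smul_eq_mul,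
      mul_one]
    have h1 : G * ∑ r ∈ words k, (expandTower r Z).length / G ≤ G * (2 ^ k + 1) := by
      calc G * ∑ r ∈ words k, (expandTower r Z).length / G
          ≤ ∑ r ∈ words k, (expandTower r Z).length := by
            rw [Finset.mul_sum]
            exact Finset.sum_le_sum fun r _ => Nat.mul_div_le _ _
        _ ≤ 3 ^ k * (2 * Z.length) := sum_words_length_expandTower_le k hZ
        _ = G * (2 ^ k + 1) := by rw [hZl, hG, hT]; ring
    have h2 := Nat.le_of_mul_le_mul_left h1 hGpos
    have h3 : 2 ^ (k + 1) = 2 * 2 ^ k := by ring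
    omega
  have hmaps : ∀ t ∈ Finset.range T, (⟨r t, pos t / G⟩ : (_ : Word) × ℕ) ∈ S := by
    intro t ht
    obtain ⟨h1, h2⟩ := h t (Finset.mem_range.1 ht)
    rw [hS, Finset.mem_sigma, Finset.mem_range]
    refine ⟨h1, Nat.lt_succ_of_le (Nat.div_le_div_right ?_)⟩
    have h3 := (expandTower_prefix (r t) (List.take_prefix (6 * (t + 1)) Z)).length_le
    rw [h2] at h3
    simp only [hpos, List.length_append] at *
    omega
  obtain ⟨t, ht, t', ht', hne, heq⟩ := Finset.exists_ne_map_eq_of_card_lt_of_maps_to hcard hmaps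
  wlog hlt : t < t' generalizing t t'
  · exact this t' ht' t ht hne.symm heq.symm (by omega)
  obtain ⟨hr, hq⟩ : r t = r t' ∧ pos t / G = pos t' / G := by simpa using heq
  obtain ⟨h1, h2⟩ := h t (Finset.mem_range.1 ht)
  obtain ⟨h1', h2'⟩ := h t' (Finset.mem_range.1 ht')
  have hpre : Z.take (6 * (t + 1)) <+: Z.take (6 * t') :=
    (List.take_prefix_take_left (by omega))
  obtain ⟨q, hqe⟩ := expandTower_prefix (r t) hpre
  rw [h2] at hqe
  rw [← hr] at h2' h1'
  have hC := expandTower_mem_Cinf (isWord_of_mem_words h1)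
    (mem_Cinf_of_isInfix hZ (List.take_prefix (6 * (t' + 1)) Z).isInfix)
  rw [h2', ← hqe] at hC
  have huzu : u ++ (y t ++ q ++ x t') ++ u ∈ Cinf :=
    mem_Cinf_of_isInfix hC ⟨expandTower (r t) (Z.take (6 * t)) ++ x t, y t', by simp⟩
  refine ⟨y t ++ q ++ x t', (isWord_of_mem_Cinf huzu).of_isInfix ⟨u, u, rfl⟩, huzu, ?_⟩
  have hp1 := Nat.mod_lt (pos t') hGpos
  have hp2 := Nat.div_add_mod (pos t) G
  have hp3 := Nat.div_add_mod (pos t') G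
  rw [← hq] at hp3
  have hp4 : pos t' = pos t + (u ++ (y t ++ q ++ x t')).length := by
    simp only [hpos, ← hr, ← hqe, List.length_append]
    ring
  rw [List.length_append]
  omega

/-- Natural numbers encoding `coef`. -/
def coefNat (l : ℕ) : ℕ :=
  [260, 254, 257, 250, 255, 251, 255, 254, 250, 259, 254, 251, 256, 256, 255].getD l 256

/-- Weights of the derivatives `D^[l] v`, `l < 15`, in the linear inequality between their
lengths. -/
def coef (l : ℕ) : ℤ := coefNat l - 256

/-- Concatenate the `b`-bit numbers `f off, …, f (off + 2 ^ d - 1)`. -/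
def packBits (b : ℕ) (f : ℕ → ℕ) : ℕ → ℕ → ℕ
  | 0, off => f off
  | d + 1, off => Nat.add (packBits b f d off)
      (Nat.shiftLeft (packBits b f d (Nat.add off (Nat.pow 2 d))) (Nat.mul b (Nat.pow 2 d)))

/-- The `i`-th `b`-bit digit of `t`. -/
def digit (b t i : ℕ) : ℕ := Nat.mod (Nat.shiftRight t (Nat.mul b i)) (Nat.pow 2 b)

/-- `f n`, arranged so that the kernel evaluates `n` first. -/
def forced {α : Type} (f : ℕ → α) (n : ℕ) : α :=
  Nat.rec (f 0) (fun k _ => f (Nat.succ k)) n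

/-- The entry for a state with index `i` below a top letter, where `t` is the table for
that letter, `o` the weight of the new top letter and `c` the shifted coefficient. -/
def stepEntry (t o c x i : ℕ) : ℕ :=
  bif Nat.beq x 1 then Nat.sub (Nat.add (digit 21 t i) (Nat.add (Nat.mul o 512) c)) 256
  else forced (fun i' => Nat.sub (Nat.add (Nat.add (digit 21 t i') (Nat.mod (digit 21 t i) 512))
      (Nat.add (Nat.mul o 512) c)) 512) (Nat.div (digit 21 t i) 512)

/-- The table entries at level `l + 1` for the input letter `x`, from the tables `t` at
level `l`. -/
def tabStep (l x : ℕ) (t : ℕ × ℕ) (j : ℕ) : ℕ :=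
  bif Nat.ble (Nat.pow 2 l) j then stepEntry t.2 0 (coefNat (l + 2)) x (Nat.sub j (Nat.pow 2 l))
  else stepEntry t.1 (Nat.pow 2 l) (coefNat (l + 2)) x j

/-- For the two input letters, the tables of next states and costs of the states of length `l`;
each entry has the index of the next state above nine bits for the cost. -/
def tab : ℕ → ℕ × ℕ
  | 0 => (258, 262)
  | l + 1 => (packBits 21 (tabStep l 1 (tab l)) (l + 1) 0,
      packBits 21 (tabStep l 2 (tab l)) (l + 1) 0)

/-- `f i` holds for all `off ≤ i < off + 2 ^ d`. -/
def allPow (f : ℕ → Bool) : ℕ → ℕ → Bool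
  | 0, off => f off
  | d + 1, off => allPow f d off && allPow f d (Nat.add off (Nat.pow 2 d))

/-- The cost stored in the `i`-th entry of `t` is at most `63` in absolute value. -/
def bounded (t i : ℕ) : Bool :=
  (fun w => Nat.ble 193 w && Nat.ble w 319) (Nat.mod (digit 21 t i) 512)

/-- Numbers whose base-`2 ^ 288` digits form the table of potentials. -/
def pot : ℕ := [
  293437224462094481653304499033954542617182498181170250366842516806118802385348194188923,
  299099903598657303283880596458699574884644361252907498069875234592600691492201548193261,
  293545395226285190090280975998583301744009238559537173074725308687881449942472607033826,
  246805400987636187682822215150976516730092656610569532233008572538136566171787273883130,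
  348822474748620506648849153713361385410353675681134906348193161837586794035606103144123,
  205150169037051505809624439756946472825595556561243299207125466227141766751730911919840,
  433552461918272600463079771544706460053901813251425419138896939410982743040281575145211,
  159040710582698828613511652648831684497900566836915108779767039143796721455277913357231,
  222156232767628027757420528628847719338309703403932853276792497700534577972697617833399,
  291722102420044783545982414925644780121211919115448930866181464966742964907039862537072,
  457188626312696217789817513044439875489614639355030090604930498852975010544189933525031,
  199062158599719734870920465661093062872128728356695505252492773611276278522998023965682,
  252233267779497889442865775947661949188258695760971991706806058113503506986350907735803,
  254206399968945185928369612820860870124130523683430394069524404038420169764238240705400,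
  262115542952556744925955089621997303124196090519753174211058202618543330984745578204008,
  141724527018671580047619237988459098518401745412440811693504406583713485320162714539943,
  346945604297675804206387229282388561224878985302252436757030627938691581704723334676149,
  260396508607912233702997312006645634805465347507989863480743562404647902340317499950446,
  464123057484861699274127783083740272134971788407063458366862825664291040798692084430513,
  347196442501452660650051291952677048519112112308851516464475161972724202064946465037359,
  182665020522292870008250711336215372465081258402677779914786100933146461369594381453678,
  411352058119146339230658221131976994606207027428231259492794104941173817788689447820341,
  354350525651902214342708002855491688110750700651921948720939765281684082348301351841144,
  267774789281799753198802437507138286229854203372417936848663851836028211807968236371707,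
  236950037404115465334644486766943535425726221711961554328999953286665903219524238286587,
  277148103796104009137904636728295078845319330859417527181155001054019645053803062242427,
  465742968317865301768057266529903283638011196038943642048560823410761080178242071714363,
  316386753917346146759044630876708754926749675011939959299303019906586699533281037090555,
  354134609518125717860266826749770358620746095462958444867198922337118179521614118807926,
  323791612206946203304926247382778538347182851218262130723534425206574273291079750229037,
  356217391940989677118198729915525569235114585863362930369943316256833817643116553451821,
  183140959315326374184153927974608986491347919108385157302986219887948133118717138513012,
  268267881033715337448757714763623197113761860102313757129332696788164426355484475972403,
  369417756176645712167923699799436096220552948649297001645777028128905079690324752631256,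
  246543362520192272305162146383346205353777356418467645824712481292118314747167160522913,
  338450924288683905508088534298796558500533714758234275783508158131095663949437499047483,
  260851806808111218745933346021903526673931440156591653812384880446985807802078184483566,
  465739525194153424368901300953487845336073571502866763253653505040402691458482654919965,
  465718394190089549620611570981365886459560801983340913404175805260947156104317797334777,
  325722419645446756051169225398887857326266446494172970544755288335745599337298008157819,
  279247147661175160907611432984441446205368546432908955702281570718818900981973330619628,
  189088631503792725200626667670708073434345245943521961806391863360740098534660204853153,
  465708938485046389544125676488343801197774398190706149911827980937534215026425604761970,
  386072711022414532994136605292817446792418504553897537239243727317072553315879894367995,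
  291475950207238986993046667911716257541621033234876471787519795004054256444508929507067,
  310329456172995632171295908482628265752302294516051764567982515088972220394985453764005,
  237439566627840740793116769931138569280890868635106301824202951274860479278266084736751,
  323620384219618502060068837895125470434298631260640875224179934837928320235065369889915,
  464874466624550109496829435516007137575996788086062161788631881465831225579140943953659,
  299847627831098658755526942332916211583817383440846160141086733835563736713401843038383,
  206375356797334302919743351525095291507489287094234842231266090269871317143929931827700,
  183661253089553726157183767722309171751315648146800917458840966561999185365956959911675,
  269767064511489927295392201747023612417649586775727101691021092831124270209393742298873,
  356350613552237369831687342899181672988563618902373317934355377721604957277798488578796,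
  347716443410133612127061334879938513864757404159487901891762892050911823413823549718267,
  283716652756730353872491723601957460506030823211559838211087706163938939611908575446890,
  290735580970358333484615547447587758793189834462272673340114623917039877465128537352946,
  361990224989108171233641920897178952792126746594919696254721833665985911354645614312505,
  457957443202462700538782459251369940912003511287855849018446768262659218868989939591278,
  228805308612178994859980047744815631864837851562069328066334770415374985873011417517160,
  252578183573861446509146166728770181162818075693622339281556186739222377679770374797619,
  332188664030128950716683538316235453932781789326984403145323375598769438013797781453928,
  182181197796890687155644111289962231363863457408893423922451953481535566140968331099002,
  252988493346790407340179618889910364419421972874630528012415498657243852817733546547385,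
  170066068617901052846848555016352768806508741812010152220636716385715914767104512847472,
  283691357591863781466945320379531509762274386787829195258699829723064865543496770215203,
  316857358890742325582116525146965363402662102380270516320094535907713128689712287370082,
  308481578272410982213873746123726419243475322036922575079678699820643979586006093319035,
  377315638817685795154005346162123132591429124975535079624790588529334276712571841747633,
  299127124061347043735490960647322966469068032930506101139133207259746924086433651566562,
  184385431580520604950573440471791820417782189973437243352435646204749786431612729126651,
  189824605111814838277804372270391075705215651691463609874793015185654703355693533994043,
  158738180975660904008367708342881950828326546121835415052341047338170595818185845058612,
  268392928405533968151213178554198605342307212313806586811512949408748173372765634987612,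
  269026964030639034819901058096800776333076353377365301751186934561091856573944811993501,
  416516107104263054356533864941722423095506045850846567807043285253306329584458459974636,
  191797820147430949580392754468332779172970926987693797809326496673707296278280686746811,
  442192288171481624186539650314335864895479388934481826172408081725278752064217173862892,
  199919010665992996026524540140974177357449846916267569014052931768088503301516813123195,
  127428230644446417675665436933144797659079345166726600313467244115655407762035450714291,
  401606475435870998497992144618530890979947814187851162696573247915521851113888296377391,
  265485100275608707551927183121428600546091786341484658224064962696191469619549558974306,
  231986796178536433090011807725727893277053086703166782765007942505054105995615665730585,
  144213746491186946438881113572429438287941527816075260648283121506562148024086567770683,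
  148157452414604343579453520158667395288528271915663431304791609087281251381033675680376,
  465746990499439365631425936236053426767956682885384922609786538172112875135343264716335,
  395319481060473757645169262929431676008770336042759393258848416729761713923299052060411,
  309213823550346981718534809231223674782401856013648824838041368230440572920547396438907,
  291240400292270949396077198782790685131554267199351779966726258810752323711406694706683,
  268510407221079970771839366072128845051584232491942491773340045908526063468676021122849,
  301828418301321577256227821760899698548134762543247871915986072794987486444010162031338,
  308732129385332547888019943124938768174906860811049463609182511107221546048024967364144,
  220167546224261882525806372938284610235419653340289703402175853675493491876633070517179,
  346711183689049115954122498300666745053808376207511878725868862786355313896587411499236,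
  419096540384896205533518314678944806728728350736427418522485389144172702434496021949292,
  223127263148231822182154767144873362897795582823767968192155833860450406924432180435759,
  306997737547867656118511931698728658368642355101853650687510755942829539542865804246779,
  331674006116540670702134473691058339935912194844295343922095212103654437571636690652269,
  176275613568417763541783577048850909385663801203550718428484160039396369033569971325288,
  340042421299756267215010340721385299789736198918110424674529952002938627815727755672442,
  173053742192676484705416001476527349040033923646378980980286520735049822984910525415099,
  219951808828468463062731746826068540415643422550543357739315215434461643032638756637146,
  355336912996330422139936902158673322155715766540641787239253951774349470958210412112758,
  127412458808435140697236773448632401572064516336671400018204624447256494004861220347447,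
  394075194972927246248510574662522288752303924956462939267956658588380941047320009489979,
  213973186251324547508764689303199314621405651951476357881039540913732948817224638905787,
  465221581138272805077064521008127064533010160101412406143955423206348534656817903573289,
  339579858942886644860191815499256619019921684141886339821213233772057257224230576016758,
  189562753042725156974898535517644905076294777544519513377419135811188566936249496206907,
  207351021036229930594625807920145588260457969508219608879265540176911581924927388732923,
  278373773149320803934219140136770905562810849128959083930802986280837340853483434601204,
  204864995346972696659199942376655541810353505076357518154461020232555136413435103484723,
  363364086092553512416311754928692483529112648127178053619601242733317320399387661942203,
  323510707833175025102199731142173732194485747925197142338646706597739036103440813410798,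
  245101720476688645152711142574346518865810429298255851183656457275578111435302351650217,
  393706837004693106306821718782707364894422751862427335527636528224199086706603711420977,
  150358369954973134484808573780571748018802591770128855601051296933305845870301554854238,
  347959440983222696204791965793716131895330336360296915148587188349388840833691096906151,
  262107658974296635285806332644145849456204998194436199362197854503854094700553237891446,
  251989890312618993030761772029695864832797008649832472427337701311548457129155855776434,
  284784164563474692732557477646379549649187801512677157817493955147329055329189373279283,
  71907747255680029485055519483315750931745299539099445793995027401272629497942467054194,
  151329932164553334354377219273904222960655373894477505503248382452263570759329582814739,
  253238687658830852633732238557383855956342953615424130406044373691864746920724556398323,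
  166142728752676085780414691581638805002010813065966100066693887365478380330846853655035,
  166393388651760170735984933742897295311109147087457283979414253408388004733027640563631,
  221643756337577195950825272968198668317838014678207216936479231082866581894993970625079,
  198944118321353631441429157344410199264780227646968788863554493887199941066604607907808,
  345986070454968424266651437691872746225459073708868798777153441006768328694084844854965,
  181225386898686304095407450514128388871960521681389099069407959310876037199253197483186,
  324501321375047957216526002153257775639136176012900267644953259509029365427790927289261,
  176013445440910853880309498157485655510132308131579764707849729138895465548237348486907,
  464358119189362394081120941829555205657509718451775790722322330028603092398040159283692,
  371148282991710416179858496593650124181367520513248312925601350110103580518649729562783,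
  394087933001695101023148935531113847598095868667392924329745443021064959870809182764601,
  322577616380294414305733303586863951464285514062255211558774396252927188927727452236912,
  277179062505780485029852139669582836861416804016750765259599865674854262322611983690600,
  410097935482565733883218711641619357092392851470997304268420827335439135698054510999843,
  309926901629120564660002694703713053969250993789752924592098869277238231950895885985910,
  298614253630244119261734205710755733282031822003458758837013087614340114677133754678073,
  150123067593216699970491167621017394639545552852312696123029787392013575668231379599099,
  182447145214172728935642687254756697124253093966711528164778770543960412549811764632119,
  236467751310050242380462122095396446057821825400355418066122714763569344962485486796333,
  196731873298940732062016009568813452520750969442170871493040192884343192326028000626656,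
  369163543505336867575767797602508739101694522349972566139218419481813637329640712760172,
  49234981875865842769498672957734955907797776641447527435942306657183705875577282136617,
  221385208249638351296647384750191875686078812180008407615823259382963529843840117500016,
  183159992826803327182881138098357325585458632886052767549574786246655838942295615318632,
  252115367208766883433650848474255594178097397913094341359107716197940764931156474468385,
  261363918017547741074144035241598439661625928521033797228385751348645029774176005093996,
  457720368764016219083689506170670137624569630817226639227889066491270641254813772520497,
  363614291925975397294710210245924897519651701625725769467876391230697844704377269791344,
  417533297143546338253389046358604765676508004971053894948985178056532161339407242546939,
  111396877116654132437149881337184023951185287934847908222544226842773011505434117986745,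
  363970875567539925247827333111731883519917124144400832820266332186854742299387586112234,
  308621981348102220764344546141440432161744154153859025169876672134511377039078114946424,
  338463914482818049820962457176147075021966162810638238409634459386418472485467474533049,
  363265430384390202320077025608330131501918516062645617012782417783350499633491799424356,
  457588829267338765063257514579497096794253805053695354819216244584541013767507573943931,
  190078699419672828332621186323122956622013289617414101697653825625212131250250675084335,
  165911052072185581414682776758172390156375531148468332400633624609090041002077895769588,
  269011550590596553890437247096627412134013618163200013207076450708128112715785579386657,
  372216302392283834778303404618357155467126510445347450468107893005273498526577981262182,
  135287502442590952423968012987874674902352860152191515205520032642411835013954578360955,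
  188576288651757595039463097386848469151810081124980795557640938691291923388597508675887,
  313959064323784058895333969453598035632301761869699554370636636144130955115798022006996,
  356076917675140223345550148971058792262725211948074008609091136724883720191798422711540,
  173809566182342445837040078975379856427827678627742886816528012181287612105067245238959,
  254441241756161807015664993649140678535009331809646748673662438304401308039760595000237,
  228793914495532032317729077116339687880482630715404360879605640200434965290452644652386,
  3295791190459956698626336070645961036808513575037927250091]
    |>.foldr (fun a b => Nat.add a (Nat.shiftLeft b 288)) 0

/-- The potential inequality for the state with index `p + i`, for both input letters. -/
def potCheck (t o c p i : ℕ) : Bool :=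
  forced (fun i₁ => Nat.ble (Nat.add (digit 6 pot (Nat.add o i₁)) 512)
      (Nat.add (digit 6 pot (Nat.add p i)) (Nat.add (Nat.mod (digit 21 t i) 512) c)) &&
    forced (fun i₂ => Nat.ble (Nat.add (digit 6 pot (Nat.add o i₂)) 768)
      (Nat.add (digit 6 pot (Nat.add p i)) (Nat.add (Nat.mod (digit 21 t i) 512)
        (Nat.add (Nat.mod (digit 21 t i₁) 512) c)))) (Nat.div (digit 21 t i₁) 512))
    (Nat.div (digit 21 t i) 512)

theorem potCheck_one : allPow (potCheck (tab 12).1 4096 (coefNat 14) 0) 12 0 = true := by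
  decide +kernel

theorem potCheck_two : allPow (potCheck (tab 12).2 0 (coefNat 14) 4096) 12 0 = true := by
  decide +kernel

theorem bounded_tab : ∀ l < 13,
    allPow (bounded (tab l).1) l 0 = true ∧ allPow (bounded (tab l).2) l 0 = true := by
  decide +kernel

theorem forced_eq {α : Type} (f : ℕ → α) (n : ℕ) : forced f n = f n := by
  cases n <;> rfl

theorem allPow_iff {f : ℕ → Bool} {d off : ℕ} :
    allPow f d off = true ↔ ∀ i < 2 ^ d, f (off + i) = true := by
  induction d generalizing off with
  | zero => simp [allPow]
  | succ d ih =>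
    have h : allPow f (d + 1) off = (allPow f d off && allPow f d (off + 2 ^ d)) := rfl
    rw [h, Bool.and_eq_true, ih, ih, pow_succ]
    refine ⟨fun ⟨h1, h2⟩ i hi => ?_, fun h => ⟨fun i hi => h i (by omega), fun i hi => ?_⟩⟩
    · by_cases hid : i < 2 ^ d
      · exact h1 i hid
      · have := h2 (i - 2 ^ d) (by omega)
        rwa [add_assoc, Nat.add_sub_cancel' (by omega)] at this
    · rw [add_assoc]
      exact h _ (by omega)

theorem digit_eq (b t i : ℕ) : digit b t i = t / 2 ^ (b * i) % 2 ^ b := by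
  rw [← Nat.shiftRight_eq_div_pow]; rfl

theorem packBits_succ (b : ℕ) (f : ℕ → ℕ) (d off : ℕ) : packBits b f (d + 1) off =
    packBits b f d off + packBits b f d (off + 2 ^ d) * 2 ^ (b * 2 ^ d) := by
  rw [← Nat.shiftLeft_eq]; rfl

theorem packBits_lt {b : ℕ} {f : ℕ → ℕ} {d off : ℕ} (hf : ∀ i < 2 ^ d, f (off + i) < 2 ^ b) :
    packBits b f d off < 2 ^ (b * 2 ^ d) := by
  induction d generalizing off with
  | zero => simpa [packBits] using hf
  | succ d ih =>
    rw [packBits_succ]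
    have h1 := ih (off := off) fun i hi => hf i (by rw [pow_succ]; omega)
    have h2 := ih (off := off + 2 ^ d) fun i hi => by
      rw [add_assoc]; exact hf _ (by rw [pow_succ]; omega)
    have h3 : 2 ^ (b * 2 ^ (d + 1)) = 2 ^ (b * 2 ^ d) * 2 ^ (b * 2 ^ d) := by
      rw [← pow_add]; ring_nf
    rw [h3]
    nlinarith

theorem digit_packBits {b : ℕ} {f : ℕ → ℕ} {d off : ℕ} (hf : ∀ i < 2 ^ d, f (off + i) < 2 ^ b)
    {i : ℕ} (hi : i < 2 ^ d) : digit b (packBits b f d off) i = f (off + i) := by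
  induction d generalizing off i with
  | zero =>
    obtain rfl : i = 0 := by simpa using hi
    have := hf 0 (by simp)
    simpa [digit_eq, packBits] using Nat.mod_eq_of_lt this
  | succ d ih =>
    have hf1 : ∀ i < 2 ^ d, f (off + i) < 2 ^ b := fun i hi => hf i (by rw [pow_succ]; omega)
    have hf2 : ∀ i < 2 ^ d, f (off + 2 ^ d + i) < 2 ^ b := fun i hi => by
      rw [add_assoc]; exact hf _ (by rw [pow_succ]; omega)
    rw [packBits_succ, digit_eq]
    by_cases hid : i < 2 ^ d
    · rw [← ih hf1 hid, digit_eq]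
      obtain ⟨e, he⟩ : ∃ e, b * 2 ^ d = b * i + b + e :=
        Nat.exists_eq_add_of_le (by calc b * i + b = b * (i + 1) := by ring
          _ ≤ b * 2 ^ d := Nat.mul_le_mul_left _ hid)
      rw [he, pow_add, pow_add, show ∀ A B : ℕ, A + B * (2 ^ (b * i) * 2 ^ b * 2 ^ e) =
        A + 2 ^ (b * i) * (2 ^ b * (B * 2 ^ e)) by intros; ring,
        Nat.add_mul_div_left _ _ (by positivity), Nat.add_mul_mod_self_left]
    · have hi' : i - 2 ^ d < 2 ^ d := by rw [pow_succ] at hi; omega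
      have := ih hf2 hi'
      rw [add_assoc, Nat.add_sub_cancel' (by omega), digit_eq] at this
      rw [← this]
      congr 1
      have hs : b * i = b * 2 ^ d + b * (i - 2 ^ d) := by
        rw [← mul_add, Nat.add_sub_cancel' (by omega)]
      rw [hs, pow_add, ← Nat.div_div_eq_div_mul, Nat.add_mul_div_right _ _ (by positivity),
        Nat.div_eq_of_lt (packBits_lt hf1), zero_add]

/-- The phases of the iterated expansions after reading `V`; the head of the list is the
letter used first. -/
def next : List ℕ → Word → List ℕ
  | [], _ => []
  | a :: s, V => bar^[V.length] a :: next s (expand a V)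

/-- The weighted total length of the iterated expansions of `W`. -/
def cost : List ℕ → Word → ℤ
  | [], W => coef 1 * W.length + coef 0 * W.sum
  | a :: s, W => coef (s.length + 2) * W.length + cost s (expand a W)

theorem length_next (s : List ℕ) (V : Word) : (next s V).length = s.length := by
  induction s generalizing V with
  | nil => rfl
  | cons a s ih => simp [next, ih]

theorem isWord_next {s : List ℕ} (hs : IsWord s) (V : Word) : IsWord (next s V) := by
  induction s generalizing V with
  | nil => exact hs
  | cons a s ih =>
    exact isWord_cons.2 ⟨bar_iterate_letter (isWord_cons.1 hs).1 _, ih (isWord_cons.1 hs).2 _⟩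

theorem next_append (s : List ℕ) (V W : Word) : next s (V ++ W) = next (next s V) W := by
  induction s generalizing V W with
  | nil => rfl
  | cons a s ih =>
    rw [next, next, next, expand_append, ih, List.length_append, add_comm,
      Function.iterate_add_apply]

theorem cost_append (s : List ℕ) (V W : Word) :
    cost s (V ++ W) = cost s V + cost (next s V) W := by
  induction s generalizing V W with
  | nil => simp [cost, next]; ring
  | cons a s ih =>
    rw [cost, cost, next, cost, expand_append, ih, List.length_append, length_next]
    push_cast
    ring

theorem next_nil (s : List ℕ) : next s [] = s := by
  induction s with
  | nil => rfl
  | cons a s ih => exact congrArg (a :: ·) ih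

theorem cost_nil (s : List ℕ) : cost s [] = 0 := by
  induction s with
  | nil => simp [cost]
  | cons a s ih => simpa [cost, expand] using ih

/-- The number with binary digits given by `s`. -/
def idx : List ℕ → ℕ
  | [] => 0
  | a :: s => (a - 1) * 2 ^ s.length + idx s

theorem idx_lt {s : List ℕ} (hs : IsWord s) : idx s < 2 ^ s.length := by
  induction s with
  | nil => simp [idx]
  | cons a s ih =>
    obtain ⟨ha, hs⟩ := isWord_cons.1 hs
    have := ih hs
    rw [idx, List.length_cons, pow_succ]
    rcases ha with rfl | rfl <;> simp <;> omega

theorem exists_idx_eq {l j : ℕ} (hj : j < 2 ^ l) : ∃ s, IsWord s ∧ s.length = l ∧ idx s = j := by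
  induction l generalizing j with
  | zero => exact ⟨[], isWord_nil, rfl, by simp [idx]; omega⟩
  | succ l ih =>
    rw [pow_succ] at hj
    by_cases h : j < 2 ^ l
    · obtain ⟨s, hs, hl, rfl⟩ := ih h
      exact ⟨1 :: s, isWord_cons.2 ⟨.inl rfl, hs⟩, by simp [hl], by simp [idx]⟩
    · obtain ⟨s, hs, hl, hi⟩ := ih (j := j - 2 ^ l) (by omega)
      exact ⟨2 :: s, isWord_cons.2 ⟨.inr rfl, hs⟩, by simp [hl], by simp [idx, hi, hl]; omega⟩

/-- The component of a pair selected by a letter. -/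
def sel (x : ℕ) (t : ℕ × ℕ) : ℕ := if x = 1 then t.1 else t.2

theorem stepEntry_one (t o c i : ℕ) :
    stepEntry t o c 1 i = digit 21 t i + (o * 512 + c) - 256 := rfl

theorem stepEntry_two (t o c i : ℕ) : stepEntry t o c 2 i =
    digit 21 t (digit 21 t i / 512) + digit 21 t i % 512 + (o * 512 + c) - 512 := by
  simp only [stepEntry, forced_eq]; rfl

theorem cost_cons_one (a : ℕ) (s : List ℕ) :
    cost (a :: s) [1] = coef (s.length + 2) + cost s [a] := by
  simp [cost, expand]

theorem cost_cons_two (a : ℕ) (s : List ℕ) :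
    cost (a :: s) [2] = coef (s.length + 2) + cost s [a] + cost (next s [a]) [a] := by
  have : expand a [2] = [a] ++ [a] := rfl
  rw [cost, this, cost_append]
  simp [add_assoc]

theorem next_cons_one (a : ℕ) (s : List ℕ) : next (a :: s) [1] = bar a :: next s [a] := rfl

theorem next_cons_two (a : ℕ) (s : List ℕ) :
    next (a :: s) [2] = bar a :: next (next s [a]) [a] := by
  rw [← next_append]; rfl

/-- The table entries for the states of length `l` are correct. -/
def TabCorrect (l : ℕ) : Prop := ∀ s x, IsWord s → s.length = l → x = 1 ∨ x = 2 →
  (digit 21 (sel x (tab l)) (idx s) : ℤ) = idx (next s [x]) * 512 + (cost s [x] + 256) ∧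
    |cost s [x]| < 256

theorem TabCorrect.abs_cost_le {l : ℕ} (h : TabCorrect l) (hl : l < 13) {s : List ℕ} {x : ℕ}
    (hs : IsWord s) (hsl : s.length = l) (hx : x = 1 ∨ x = 2) : |cost s [x]| ≤ 63 := by
  obtain ⟨h1, h2⟩ := h s x hs hsl hx
  obtain ⟨hb1, hb2⟩ := bounded_tab l hl
  have hi := idx_lt hs
  rw [hsl] at hi
  have hb : bounded (sel x (tab l)) (idx s) = true := by
    rcases hx with rfl | rfl
    · simpa [sel] using allPow_iff.1 hb1 _ hi
    · simpa [sel] using allPow_iff.1 hb2 _ hi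
  have hb' : 193 ≤ digit 21 (sel x (tab l)) (idx s) % 512 ∧
      digit 21 (sel x (tab l)) (idx s) % 512 ≤ 319 := by
    have h := (Bool.and_eq_true _ _).mp hb
    exact ⟨Nat.le_of_ble_eq_true h.1, Nat.le_of_ble_eq_true h.2⟩
  rw [abs_lt] at h2
  rw [abs_le]
  omega

theorem abs_coef_le {l : ℕ} (hl : l < 15) : |coef l| ≤ 6 := by
  interval_cases l <;> simp [coef, coefNat]

theorem TabCorrect.step {l : ℕ} (h : TabCorrect l) (hl : l < 12) {a : ℕ} {s : List ℕ} {x : ℕ}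
    (ha : a = 1 ∨ a = 2) (hs : IsWord s) (hsl : s.length = l) (hx : x = 1 ∨ x = 2) :
    (stepEntry (sel a (tab l)) ((bar a - 1) * 2 ^ l) (coefNat (l + 2)) x (idx s) : ℤ) =
      idx (next (a :: s) [x]) * 512 + (cost (a :: s) [x] + 256) ∧ |cost (a :: s) [x]| < 256 := by
  have hc := abs_coef_le (l := l + 2) (by omega)
  have hcn : (coefNat (l + 2) : ℤ) = coef (l + 2) + 256 := by simp [coef]
  have e1 := (h s a hs hsl ha).1
  have b1 := h.abs_cost_le (by omega) hs hsl ha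
  have hn := isWord_next hs [a]
  have hnl : (next s [a]).length = l := by rw [length_next, hsl]
  have e2 := (h _ a hn hnl ha).1
  have b2 := h.abs_cost_le (by omega) hn hnl ha
  rw [abs_le] at hc b1 b2
  rcases hx with rfl | rfl
  · rw [stepEntry_one, cost_cons_one, next_cons_one, idx, hnl, hsl, abs_lt]
    generalize (bar a - 1) * 2 ^ l = o
    push_cast
    omega
  · have hdiv : digit 21 (sel a (tab l)) (idx s) / 512 = idx (next s [a]) := by omega
    rw [stepEntry_two, cost_cons_two, next_cons_two, idx, length_next, hnl, hsl, abs_lt, hdiv]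
    generalize (bar a - 1) * 2 ^ l = o
    push_cast
    omega

theorem tabStep_idx {l : ℕ} {a x : ℕ} {s : List ℕ} (ha : a = 1 ∨ a = 2) (hs : IsWord s)
    (hsl : s.length = l) : tabStep l x (tab l) (idx (a :: s)) =
      stepEntry (sel a (tab l)) ((bar a - 1) * 2 ^ l) (coefNat (l + 2)) x (idx s) := by
  have hi := idx_lt hs
  rw [hsl] at hi
  rcases ha with rfl | rfl
  · have : Nat.ble (Nat.pow 2 l) (idx (1 :: s)) = false := by
      rw [← Bool.not_eq_true, Nat.ble_eq]
      simpa [idx] using hi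
    rw [tabStep, this]
    simp [idx, sel, bar]
  · have : Nat.ble (Nat.pow 2 l) (idx (2 :: s)) = true := by
      rw [Nat.ble_eq]
      simp [idx, hsl]
    rw [tabStep, this]
    simp [idx, sel, bar, hsl]

theorem tabCorrect {l : ℕ} (hl : l < 13) : TabCorrect l := by
  induction l with
  | zero =>
    intro s x _ hsl hx
    obtain rfl : s = [] := List.length_eq_zero_iff.1 hsl
    rcases hx with rfl | rfl <;>
      simp [sel, tab, digit_eq, idx, next, cost, coef, coefNat]
  | succ l ih =>
    have ih := ih (by omega)
    have hstep : ∀ s x, IsWord s → s.length = l + 1 → x = 1 ∨ x = 2 →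
        (tabStep l x (tab l) (idx s) : ℤ) = idx (next s [x]) * 512 + (cost s [x] + 256) ∧
          |cost s [x]| < 256 := by
      intro s x hs hsl hx
      cases s with
      | nil => simp at hsl
      | cons a s =>
        obtain ⟨ha, hs⟩ := isWord_cons.1 hs
        have hsl : s.length = l := by simpa using hsl
        rw [tabStep_idx ha hs hsl]
        exact ih.step (by omega) ha hs hsl hx
    intro s x hs hsl hx
    obtain ⟨h1, h2⟩ := hstep s x hs hsl hx
    refine ⟨?_, h2⟩
    rw [← h1]
    have hsel : sel x (tab (l + 1)) = packBits 21 (tabStep l x (tab l)) (l + 1) 0 := by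
      rcases hx with rfl | rfl <;> rfl
    have hi := idx_lt hs
    rw [hsl] at hi
    rw [hsel, digit_packBits _ hi, zero_add]
    intro j hj
    obtain ⟨s, hs, hsl, rfl⟩ := exists_idx_eq hj
    obtain ⟨h1, h2⟩ := hstep s x hs hsl hx
    have hn := idx_lt (isWord_next hs [x])
    rw [length_next, hsl] at hn
    have h12 : 2 ^ (l + 1) ≤ 2 ^ 12 := Nat.pow_le_pow_right (by norm_num) (by omega)
    rw [zero_add]
    rw [abs_lt] at h2
    norm_num at h12 ⊢
    omega

/-- A bounded function on states of length `13` whose increments are bounded by costs. -/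
def potential (s : List ℕ) : ℕ := digit 6 pot (idx s)

theorem le_of_potCheck {t o c p i : ℕ} (h : potCheck t o c p i = true) :
    digit 6 pot (o + digit 21 t i / 512) + 512 ≤
      digit 6 pot (p + i) + (digit 21 t i % 512 + c) ∧
    digit 6 pot (o + digit 21 t (digit 21 t i / 512) / 512) + 768 ≤
      digit 6 pot (p + i) +
        (digit 21 t i % 512 + (digit 21 t (digit 21 t i / 512) % 512 + c)) := by
  simp only [potCheck, forced_eq] at h
  obtain ⟨h1, h2⟩ := (Bool.and_eq_true _ _).mp h
  exact ⟨Nat.le_of_ble_eq_true h1, Nat.le_of_ble_eq_true h2⟩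

theorem potential_next_singleton_le {s : List ℕ} (hs : IsWord s) (hsl : s.length = 13) {x : ℕ}
    (hx : x = 1 ∨ x = 2) : (potential (next s [x]) : ℤ) ≤ potential s + cost s [x] := by
  cases s with
  | nil => simp at hsl
  | cons a s =>
    obtain ⟨ha, hs⟩ := isWord_cons.1 hs
    have hsl : s.length = 12 := by simpa using hsl
    have h := tabCorrect (l := 12) (by norm_num)
    have hi := idx_lt hs
    rw [hsl] at hi
    have hcheck : potCheck (sel a (tab 12)) ((bar a - 1) * 2 ^ 12) (coefNat 14)
        ((a - 1) * 2 ^ 12) (idx s) = true := by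
      rcases ha with rfl | rfl
      · simpa [sel, bar] using allPow_iff.1 potCheck_one _ hi
      · simpa [sel, bar] using allPow_iff.1 potCheck_two _ hi
    have hcn : (coefNat 14 : ℤ) = coef (12 + 2) + 256 := by simp [coef]
    obtain ⟨e1, b1⟩ := h s a hs hsl ha
    have hnl : (next s [a]).length = 12 := by rw [length_next, hsl]
    obtain ⟨e2, b2⟩ := h _ a (isWord_next hs [a]) hnl ha
    rw [abs_lt] at b1 b2
    have hdiv : digit 21 (sel a (tab 12)) (idx s) / 512 = idx (next s [a]) := by omega
    have hdiv' : digit 21 (sel a (tab 12)) (idx (next s [a])) / 512 =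
      idx (next (next s [a]) [a]) := by omega
    obtain ⟨h1, h2⟩ := le_of_potCheck hcheck
    rw [hdiv] at h1 h2
    rw [hdiv'] at h2
    rcases hx with rfl | rfl
    · rw [cost_cons_one, next_cons_one, potential, potential, idx, idx, hnl, hsl]
      omega
    · rw [cost_cons_two, next_cons_two, potential, potential, idx, idx, length_next, hnl, hsl]
      omega

theorem potential_next_le {s : List ℕ} (hs : IsWord s) (hsl : s.length = 13) {W : Word}
    (hW : IsWord W) : (potential (next s W) : ℤ) ≤ potential s + cost s W := by
  induction W generalizing s with
  | nil =>
    rw [next_nil, cost_nil, add_zero]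
  | cons x W ih =>
    obtain ⟨hx, hW⟩ := isWord_cons.1 hW
    have h1 := potential_next_singleton_le hs hsl hx
    have h2 := ih (isWord_next hs [x]) (by rw [length_next, hsl]) hW
    rw [← List.singleton_append, next_append, cost_append]
    omega

theorem neg_le_cost {s : List ℕ} (hs : IsWord s) (hsl : s.length = 13) {W : Word}
    (hW : IsWord W) : -63 ≤ cost s W := by
  have h := potential_next_le hs hsl hW
  have hlt : potential s < 64 := by
    rw [potential, digit_eq]; exact Nat.mod_lt _ (by norm_num)
  omega

theorem iterate_D_mem_Cinf {v : Word} (hv : v ∈ Cinf) (j : ℕ) : D^[j] v ∈ Cinf := by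
  induction j with
  | zero => exact hv
  | succ j ih => rw [Function.iterate_succ_apply']; exact (mem_Cinf_iff.1 ih).2

theorem exists_eq_append_expand_infix {v : Word} (hv : Diffble v) {X V Y : Word}
    (h : D v = X ++ V ++ Y) : ∃ a X' Y', (a = 1 ∨ a = 2) ∧ v = X' ++ expand a V ++ Y' ∧
      X'.length + Y'.length ≤ X.sum + Y.sum + 2 := by
  obtain ⟨c, A, B, hc, hA, hB, hv⟩ := exists_eq_append_expand_D hv
  rw [h, expand_append, expand_append] at hv
  refine ⟨_, A ++ expand c X, expand (bar^[(X ++ V).length] c) Y ++ B,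
    bar_iterate_letter hc X.length, by rw [hv]; simp only [List.append_assoc], ?_⟩
  have hA' : A.length ≤ 1 := by rcases hA with rfl | rfl <;> simp
  have hB' : B.length ≤ 1 := by rcases hB with rfl | rfl <;> simp
  simp only [List.length_append, length_expand]
  omega

theorem mul_le_mul_add {c x y : ℤ} {K : ℕ} (h1 : x ≤ y) (h2 : y ≤ x + K) :
    c * x ≤ c * y + |c| * K := by
  nlinarith [neg_abs_le c, le_abs_self c, abs_nonneg c]

/-- The cost of a word is controlled by the weighted lengths of the derivatives of any word
having it as derivative, up to bounded margins. -/
theorem exists_cost_le (j : ℕ) : ∀ K : ℕ, ∃ B : ℤ, ∀ v ∈ Cinf, ∀ X V Y : Word,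
    D^[j + 1] v = X ++ V ++ Y → X.length + Y.length ≤ K →
      ∃ s, IsWord s ∧ s.length = j ∧
        cost s V ≤ ∑ l ∈ Finset.range (j + 2), coef l * (D^[l] v).length + B := by
  have hmargin : ∀ {v X V Y : Word} {K : ℕ}, v ∈ Cinf → D v = X ++ V ++ Y →
      X.length + Y.length ≤ K → ∃ a X' Y', (a = 1 ∨ a = 2) ∧ v = X' ++ expand a V ++ Y' ∧
        X'.length + Y'.length ≤ 2 * K + 2 := by
    intro v X V Y K hv h hK
    obtain ⟨a, X', Y', ha, he, hl⟩ := exists_eq_append_expand_infix (mem_Cinf_iff.1 hv).1 h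
    have hw := isWord_of_mem_Cinf (mem_Cinf_iff.1 hv).2
    rw [h, isWord_append, isWord_append] at hw
    have h1 := hw.1.1.sum_le
    have h2 := hw.2.sum_le
    exact ⟨a, X', Y', ha, he, by omega⟩
  induction j with
  | zero =>
    intro K
    refine ⟨|coef 1| * K + |coef 0| * (2 * K + 2 : ℕ), fun v hv X V Y h hK => ?_⟩
    obtain ⟨a, X', Y', -, he, hl⟩ := hmargin hv h hK
    refine ⟨[], isWord_nil, rfl, ?_⟩
    have h1 : (D v).length = X.length + V.length + Y.length := by
      rw [show D v = _ from h]; simp [add_assoc]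
    have h0 : v.length = X'.length + V.sum + Y'.length := by
      rw [he]; simp [length_expand, add_assoc]
    have i1 := mul_le_mul_add (c := coef 1) (x := V.length) (y := (D v).length) (K := K)
      (by omega) (by omega)
    have i0 := mul_le_mul_add (c := coef 0) (x := V.sum) (y := v.length) (K := 2 * K + 2)
      (by omega) (by omega)
    simp only [Finset.sum_range_succ, Finset.sum_range_zero, cost, Function.iterate_zero, id,
      Function.iterate_one]
    linarith
  | succ j ih =>
    intro K
    obtain ⟨B, hB⟩ := ih (2 * K + 2)
    refine ⟨B + |coef (j + 2)| * K, fun v hv X V Y h hK => ?_⟩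
    rw [Function.iterate_succ_apply'] at h
    obtain ⟨a, X', Y', ha, he, hl⟩ := hmargin (iterate_D_mem_Cinf hv _) h hK
    obtain ⟨s, hs, hsl, hc⟩ := hB v hv X' _ Y' he hl
    refine ⟨a :: s, isWord_cons.2 ⟨ha, hs⟩, by simp [hsl], ?_⟩
    have h1 : (D^[j + 2] v).length = X.length + V.length + Y.length := by
      rw [Function.iterate_succ_apply', h]; simp [add_assoc]
    have i1 := mul_le_mul_add (c := coef (j + 2)) (x := V.length) (y := (D^[j + 2] v).length)
      (K := K) (by omega) (by omega)
    rw [Finset.sum_range_succ, cost, hsl]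
    linarith

/-- A linear inequality between the lengths of the first derivatives of a C∞-word. -/
theorem exists_neg_le_sum_coef : ∃ B : ℤ, ∀ v ∈ Cinf,
    -B ≤ ∑ l ∈ Finset.range 15, coef l * (D^[l] v).length := by
  obtain ⟨B, hB⟩ := exists_cost_le 13 0
  refine ⟨B + 63, fun v hv => ?_⟩
  obtain ⟨s, hs, hsl, h⟩ := hB v hv [] (D^[14] v) [] (by simp) (by simp)
  have := neg_le_cost hs hsl (isWord_of_mem_Cinf (iterate_D_mem_Cinf hv 14))
  linarith

theorem length_D_lt {v : Word} (hv : v ∈ Cinf) (hne : v ≠ []) : (D v).length < v.length := by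
  obtain ⟨a, W, ha, hW, rfl⟩ := (mem_Cinf_iff.1 hv).1.exists_expand
  rw [D_expand ha hW, length_expand]
  cases W with
  | nil => exact absurd rfl hne
  | cons x W =>
    obtain ⟨hx, hW'⟩ := isWord_cons.1 hW
    have hs := hW'.length_le_sum
    rw [List.sum_cons]
    rcases hx with rfl | rfl
    · have : (trim (1 :: W)).length ≤ W.length := by
        have h := (dropOne_suffix W.reverse).length_le
        rw [List.length_reverse] at h
        simpa [trim, dropOne] using h
      omega
    · have := (trim_infix (2 :: W)).length_le
      rw [List.length_cons] at this
      omega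

theorem D_nil : D [] = [] := by simp [D, dropFirstRun1]

theorem length_iterate_D_le {v : Word} (hv : v ∈ Cinf) (j : ℕ) : (D^[j] v).length ≤ v.length := by
  induction j with
  | zero => exact le_rfl
  | succ j ih =>
    rw [Function.iterate_succ_apply']
    by_cases h : D^[j] v = []
    · simp [h, D_nil]
    · exact (length_D_lt (iterate_D_mem_Cinf hv j) h).le.trans ih

theorem exists_iterate_D_eq_nil {v : Word} (hv : v ∈ Cinf) : ∃ k, D^[k] v = [] := by
  by_contra! h
  have key : ∀ j, (D^[j] v).length + j ≤ v.length := by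
    intro j
    induction j with
    | zero => simp
    | succ j ih =>
      have := length_D_lt (iterate_D_mem_Cinf hv j) (h j)
      rw [Function.iterate_succ_apply']
      omega
  have := key (v.length + 1)
  omega

/-- The growth rate of C∞-words as a function of their height. -/
noncomputable def growth : ℝ := 149766 / 100000

/-- A positive linear combination of `n 0, …, n 13`. -/
noncomputable def weightedSum (n : ℕ → ℝ) : ℝ :=
  4 * n 0 + 3.9907 * n 1 + 6.9768 * n 2 + 4.4489 * n 3 + 5.663 * n 4 + 3.4813 * n 5 +
  4.2139 * n 6 + 4.311 * n 7 + 0.4565 * n 8 + 3.6837 * n 9 + 3.517 * n 10 + 0.2673 * n 11 +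
  0.4004 * n 12 + 0.5997 * n 13

theorem growth_mul_weightedSum_le {n : ℕ → ℝ} (hn : ∀ l, 0 ≤ n l) {B : ℝ}
    (h : -B ≤ ∑ l ∈ Finset.range 15, coef l * n l) :
    growth * weightedSum (fun l => n (l + 1)) ≤ weightedSum n + B := by
  simp only [Finset.sum_range_succ, Finset.sum_range_zero, coef, coefNat, List.getD_cons_zero,
    List.getD_cons_succ] at h
  norm_num at h
  simp only [weightedSum, growth]
  linarith [hn 0, hn 1, hn 2, hn 3, hn 4, hn 5, hn 6, hn 7, hn 8, hn 9, hn 10, hn 11, hn 12,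
    hn 13, hn 14]

/-- A weighted length of a word that grows geometrically under taking primitives. -/
noncomputable def weightedLength (v : Word) : ℝ := weightedSum fun l => (D^[l] v).length

theorem exists_growth_mul_weightedLength_le : ∃ B : ℝ, 0 ≤ B ∧ ∀ v ∈ Cinf,
    growth * weightedLength (D v) ≤ weightedLength v + B := by
  obtain ⟨B, hB⟩ := exists_neg_le_sum_coef
  refine ⟨|(B : ℝ)|, abs_nonneg _, fun v hv => ?_⟩
  refine growth_mul_weightedSum_le (n := fun l => (D^[l] v).length)
    (fun l => Nat.cast_nonneg _) ?_
  exact (neg_le_neg (le_abs_self _)).trans (by exact_mod_cast hB v hv)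

theorem weightedLength_le {v : Word} (hv : v ∈ Cinf) : weightedLength v ≤ 47 * v.length := by
  have key : ∀ (n : ℕ → ℝ) (x : ℝ), 0 ≤ x → (∀ l, n l ≤ x) → weightedSum n ≤ 47 * x := by
    intro n x hx hn
    rw [weightedSum]
    linarith [hn 0, hn 1, hn 2, hn 3, hn 4, hn 5, hn 6, hn 7, hn 8, hn 9, hn 10, hn 11, hn 12,
      hn 13]
  exact key _ _ (Nat.cast_nonneg _) fun l => by exact_mod_cast length_iterate_D_le hv l

theorem le_weightedLength (v : Word) : 4 * (v.length : ℝ) ≤ weightedLength v := by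
  have key : ∀ n : ℕ → ℝ, (∀ l, 0 ≤ n l) → 4 * n 0 ≤ weightedSum n := by
    intro n hn
    rw [weightedSum]
    linarith [hn 1, hn 2, hn 3, hn 4, hn 5, hn 6, hn 7, hn 8, hn 9, hn 10, hn 11, hn 12, hn 13]
  exact key (fun l => ((D^[l] v).length : ℝ)) fun l => Nat.cast_nonneg _

theorem one_lt_growth : 1 < growth := by norm_num [growth]

/-- Words of height `k` have length of order at least `growth ^ k`. -/
theorem exists_growth_pow_le : ∃ A : ℝ, 0 < A ∧ ∀ u ∈ Cinf, u ≠ [] →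
    ∃ k, D^[k] u = [] ∧ growth ^ k ≤ A * u.length := by
  obtain ⟨B, hB0, hB⟩ := exists_growth_mul_weightedLength_le
  have hg := one_lt_growth
  have hg0 : 0 < growth := by linarith
  set β := B / (growth - 1) with hβ
  have hβ0 : 0 ≤ β := div_nonneg hB0 (by linarith)
  have hβ1 : β * (growth - 1) = B := div_mul_cancel₀ _ (by linarith)
  obtain ⟨M, hM⟩ := exists_nat_ge β
  refine ⟨growth ^ (M + 1) * 47, by positivity, fun u hu hne => ?_⟩
  have hex := exists_iterate_D_eq_nil hu
  refine ⟨Nat.find hex, Nat.find_spec hex, ?_⟩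
  set k := Nat.find hex with hk
  have hne' : ∀ j < k, D^[j] u ≠ [] := fun j hj => Nat.find_min hex hj
  have hu1 : (1 : ℝ) ≤ u.length := by
    exact_mod_cast List.length_pos_iff.2 hne
  by_cases hkM : k ≤ M + 1
  · calc growth ^ k ≤ growth ^ (M + 1) := pow_le_pow_right₀ hg.le hkM
      _ ≤ growth ^ (M + 1) * 47 * u.length := by
        have : 0 < growth ^ (M + 1) := by positivity
        nlinarith
  · obtain ⟨i, hi⟩ : ∃ i, k = i + (M + 1) := ⟨k - (M + 1), by omega⟩
    have hlong : M + 1 ≤ (D^[i] u).length := by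
      have : ∀ j ≤ M + 1, j ≤ (D^[k - j] u).length := by
        intro j
        induction j with
        | zero => intro _; exact Nat.zero_le _
        | succ j ih =>
          intro hj
          have h1 := ih (by omega)
          have h2 := length_D_lt (iterate_D_mem_Cinf hu (k - (j + 1)))
            (hne' (k - (j + 1)) (by omega))
          rw [← Function.iterate_succ_apply' D, show (k - (j + 1)).succ = k - j by omega] at h2
          omega
      have h := this (M + 1) le_rfl
      rwa [show k - (M + 1) = i by omega] at h
    have hz : ∀ j, growth ^ j * (weightedLength (D^[j] u) - β) ≤ weightedLength u - β := by
      intro j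
      induction j with
      | zero => simp
      | succ j ih =>
        refine le_trans ?_ ih
        have h := hB _ (iterate_D_mem_Cinf hu j)
        rw [← Function.iterate_succ_apply' D] at h
        rw [pow_succ, mul_assoc]
        refine mul_le_mul_of_nonneg_left ?_ (by positivity)
        linarith
    have h1 : 1 ≤ weightedLength (D^[i] u) - β := by
      have h2 := le_weightedLength (D^[i] u)
      have h3 : ((M + 1 : ℕ) : ℝ) ≤ (D^[i] u).length := by exact_mod_cast hlong
      push_cast at h3
      linarith
    have hgi : growth ^ i ≤ 47 * u.length :=
      calc growth ^ i ≤ growth ^ i * (weightedLength (D^[i] u) - β) :=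
            le_mul_of_one_le_right (by positivity) h1
        _ ≤ weightedLength u - β := hz i
        _ ≤ 47 * u.length := by linarith [weightedLength_le hu]
    calc growth ^ k = growth ^ (M + 1) * growth ^ i := by rw [hi, pow_add, mul_comm]
      _ ≤ growth ^ (M + 1) * (47 * u.length) := by gcongr
      _ = growth ^ (M + 1) * 47 * u.length := by ring

theorem three_le_growth_rpow : (3 : ℝ) ≤ growth ^ (2.72 : ℝ) := by
  have hg : 0 < growth := by linarith [one_lt_growth]
  refine le_of_pow_le_pow_left₀ (n := 25) (by norm_num) (by positivity) ?_
  rw [← Real.rpow_natCast (growth ^ (2.72 : ℝ)), ← Real.rpow_mul hg.le,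
    show (2.72 : ℝ) * (25 : ℕ) = (68 : ℕ) by norm_num, Real.rpow_natCast, growth]
  norm_num

end CinftyWords

open CinftyWords in
/-- There is a constant `C > 0` such that every nonempty C∞-word `u` admits a word `z`
over Σ with `uzu ∈ C∞` and `|uzu| ≤ C·|u|^{2.72}`. -/
theorem repetition_with_gap_subcubic :
    ∃ C : ℝ, 0 < C ∧ ∀ u : Word, u ∈ Cinf → u ≠ [] →
      ∃ z : Word, IsWord z ∧ u ++ z ++ u ∈ Cinf ∧
        ((u ++ z ++ u).length : ℝ) ≤ C * (u.length : ℝ) ^ (2.72 : ℝ) := by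
  obtain ⟨A, hA, h⟩ := exists_growth_pow_le
  refine ⟨24 * A ^ (2.72 : ℝ) + 1, by positivity, fun u hu hne => ?_⟩
  obtain ⟨k, hk, hgk⟩ := h u hu hne
  obtain ⟨z, hz, huzu, hl⟩ := exists_repetition hu hk
  refine ⟨z, hz, huzu, ?_⟩
  have hg : 0 < growth := by linarith [one_lt_growth]
  have hu1 : (1 : ℝ) ≤ u.length := by exact_mod_cast List.length_pos_iff.2 hne
  have h3 : (3 : ℝ) ^ k ≤ A ^ (2.72 : ℝ) * (u.length : ℝ) ^ (2.72 : ℝ) :=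
    calc (3 : ℝ) ^ k ≤ (growth ^ (2.72 : ℝ)) ^ k :=
          pow_le_pow_left₀ (by norm_num) three_le_growth_rpow k
      _ = (growth ^ k) ^ (2.72 : ℝ) := by
          rw [← Real.rpow_natCast, ← Real.rpow_natCast, ← Real.rpow_mul hg.le,
            ← Real.rpow_mul hg.le, mul_comm]
      _ ≤ (A * u.length) ^ (2.72 : ℝ) := by gcongr
      _ = _ := Real.mul_rpow hA.le (by positivity)
  have h1 : (u.length : ℝ) ≤ (u.length : ℝ) ^ (2.72 : ℝ) :=
    Real.self_le_rpow_of_one_le hu1 (by norm_num)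
  calc ((u ++ z ++ u).length : ℝ) ≤ 24 * 3 ^ k + u.length := by exact_mod_cast hl
    _ ≤ 24 * (A ^ (2.72 : ℝ) * (u.length : ℝ) ^ (2.72 : ℝ)) + (u.length : ℝ) ^ (2.72 : ℝ) := by
        gcongr
    _ = _ := by ring
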